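/- R_w is determined by its values at rational arguments: for every positive word w in n letters and every s₁, …, sₙ ∈ ℝ, one has R_w(s₁,…,sₙ) = inf { R_w(r₁,…,rₙ) : r₁,…,rₙ ∈ ℚ with rᵢ ≥ sᵢ for all i }. -/

import Mathlib

open CircleDeg1Lift

/-- Translation number of an element of `Homeo_ℤ(ℝ) = CircleDeg1Liftˣ`. -/
noncomputable def tau (f : CircleDeg1Liftˣ) : ℝ :=
  translationNumber (f : CircleDeg1Lift)

/-- The set of translation numbers `τ(w(f₁,…,fₙ))` over all tuples `fᵢ ∈ Homeo_ℤ(ℝ)`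
with `τ(fᵢ) = sᵢ`. -/
def rotSet {n : ℕ} (w : FreeMonoid (Fin n)) (s : Fin n → ℝ) : Set ℝ :=
  {y | ∃ f : Fin n → CircleDeg1Liftˣ, (∀ i, tau (f i) = s i) ∧ y = tau (FreeMonoid.lift f w)}

/-- `R_w(s₁,…,sₙ) = sup { τ(w(f₁,…,fₙ)) : τ(fᵢ) = sᵢ }`. -/
noncomputable def Rw {n : ℕ} (w : FreeMonoid (Fin n)) (s : Fin n → ℝ) : ℝ :=
  sSup (rotSet w s)

/-! ### Raising the translation number -/

section TranslationNumber

variable (f : CircleDeg1Liftˣ)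

theorem CircleDeg1Lift.continuous_units : Continuous (f : CircleDeg1Lift) :=
  (CircleDeg1Lift.continuous_iff_surjective _).2
    (CircleDeg1Lift.isUnit_iff_bijective.1 f.isUnit).surjective

theorem continuous_tau_translate_mul :
    Continuous fun c : ℝ => tau (translate (Multiplicative.ofAdd c) * f) := by
  set g : ℝ → CircleDeg1Lift := fun c => ((translate (Multiplicative.ofAdd c) * f : CircleDeg1Liftˣ) :
    CircleDeg1Lift) with hg
  have hgx : ∀ c x, g c x = c + f x := fun c x => by simp [hg]
  have hpow : ∀ n : ℕ, Continuous fun c => (g c ^ n) 0 := by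
    intro n
    induction n with
    | zero => simpa using continuous_const
    | succ n ih =>
      simp only [pow_succ', CircleDeg1Lift.mul_apply, hgx]
      exact continuous_id.add ((CircleDeg1Lift.continuous_units f).comp ih)
  have hunif : TendstoUniformly (fun (n : ℕ) c => (g c ^ (n + 1)) 0 / ((n : ℝ) + 1))
      (fun c => tau (translate (Multiplicative.ofAdd c) * f)) Filter.atTop := by
    rw [Metric.tendstoUniformly_iff]
    intro ε hε
    filter_upwards [(tendsto_one_div_add_atTop_nhds_zero_nat (𝕜 := ℝ)).eventually_lt_const hε]
      with n hn c
    refine lt_of_le_of_lt ?_ hn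
    have hn0 : (0 : ℝ) < n + 1 := by positivity
    have h := (g c).dist_pow_map_zero_mul_translationNumber_le (n + 1)
    rw [Real.dist_eq, abs_sub_comm] at h
    push_cast at h
    rw [Real.dist_eq, le_div_iff₀ hn0, ← abs_of_pos hn0, ← abs_mul, abs_of_pos hn0, sub_mul,
      div_mul_cancel₀ _ hn0.ne', mul_comm]
    exact h
  exact hunif.continuous (Filter.Frequently.of_forall fun n => (hpow (n + 1)).div_const _)

theorem exists_ge_tau_eq {t : ℝ} (ht : tau f ≤ t) :
    ∃ g : CircleDeg1Liftˣ, (f : CircleDeg1Lift) ≤ g ∧ tau g = t := by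
  have h0 : tau (translate (Multiplicative.ofAdd (0 : ℝ)) * f) = tau f := by simp
  have hC : t ≤ tau (translate (Multiplicative.ofAdd (t - tau f + 2)) * f) := by
    have h1 := (f : CircleDeg1Lift).dist_map_zero_translationNumber_le
    have h2 := ((translate (Multiplicative.ofAdd (t - tau f + 2)) * f : CircleDeg1Liftˣ) :
      CircleDeg1Lift).dist_map_zero_translationNumber_le
    rw [Real.dist_eq, abs_le] at h1 h2
    simp only [Units.val_mul, CircleDeg1Lift.mul_apply, translate_apply] at h2
    simp only [tau, Units.val_mul] at *
    linarith [h1.1, h2.2]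
  obtain ⟨c, hc, hct⟩ := intermediate_value_Icc (by linarith : (0 : ℝ) ≤ t - tau f + 2)
    (continuous_tau_translate_mul f).continuousOn ⟨h0.trans_le ht, hC⟩
  refine ⟨_, fun x => ?_, hct⟩
  have : f x ≤ c + f x := by linarith [hc.1]
  simpa using this

end TranslationNumber

/-! ### Circle maps contracting onto a finite set -/

section Contraction

variable (A : Finset ℝ)

/-- Distance on the circle `ℝ / ℤ` from the class of `x` to the classes of the points of `A`. -/
noncomputable def circleInfDist (x : ℝ) : ℝ :=
  Metric.infDist (x : AddCircle (1 : ℝ)) ((fun a : ℝ => (a : AddCircle (1 : ℝ))) '' A)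

theorem circleInfDist_add_one (x : ℝ) : circleInfDist A (x + 1) = circleInfDist A x := by
  simp [circleInfDist]

theorem circleInfDist_nonneg (x : ℝ) : 0 ≤ circleInfDist A x := Metric.infDist_nonneg

theorem circleInfDist_le_add (x y : ℝ) : circleInfDist A x ≤ circleInfDist A y + |x - y| := by
  refine (Metric.infDist_le_infDist_add_dist (y := (y : AddCircle (1 : ℝ)))).trans ?_
  rw [circleInfDist]
  gcongr
  rw [dist_eq_norm, ← AddCircle.coe_sub]
  exact QuotientAddGroup.norm_mk_le_norm

theorem continuous_circleInfDist : Continuous (circleInfDist A) :=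
  (Metric.continuous_infDist_pt _).comp (AddCircle.continuous_mk' 1)

variable {A}

theorem circleInfDist_eq_zero_iff (hA : A.Nonempty) {x : ℝ} :
    circleInfDist A x = 0 ↔ ∃ a ∈ A, ∃ k : ℤ, x = a + k := by
  rw [circleInfDist, ← (A.finite_toSet.image _).isClosed.mem_iff_infDist_zero
    ((Finset.coe_nonempty.2 hA).image _)]
  constructor
  · rintro ⟨a, ha, h⟩
    obtain ⟨k, hk⟩ := AddSubgroup.mem_zmultiples_iff.1 (QuotientAddGroup.eq.1 h)
    simp only [zsmul_eq_mul, mul_one] at hk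
    exact ⟨a, ha, k, by linarith⟩
  · rintro ⟨a, ha, k, rfl⟩
    exact ⟨a, ha, by simp⟩

variable (A)

/-- The homeomorphism of the circle that moves each point towards the nearest point of `A` on
its left, fixing exactly the points of `A`. -/
noncomputable def contraction : CircleDeg1Lift where
  toFun x := x - circleInfDist A x / 2
  monotone' x y h := by
    have := circleInfDist_le_add A y x
    rw [abs_of_nonneg (sub_nonneg.2 h)] at this
    simp only
    linarith
  map_add_one' x := by simp only [circleInfDist_add_one]; ring

theorem contraction_apply (x : ℝ) : contraction A x = x - circleInfDist A x / 2 := rfl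

theorem contraction_le (x : ℝ) : contraction A x ≤ x := by
  have := circleInfDist_nonneg A x
  rw [contraction_apply]; linarith

theorem continuous_contraction : Continuous (contraction A) :=
  continuous_id.sub ((continuous_circleInfDist A).div_const 2)

theorem isUnit_contraction : IsUnit (contraction A) := by
  refine CircleDeg1Lift.isUnit_iff_bijective.2
    ⟨?_, (CircleDeg1Lift.continuous_iff_surjective _).1 (continuous_contraction A)⟩
  refine StrictMono.injective fun x y h => ?_
  have := circleInfDist_le_add A y x
  rw [abs_of_pos (sub_pos.2 h)] at this
  rw [contraction_apply, contraction_apply]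
  linarith

variable {A}

theorem contraction_eq_self_iff (hA : A.Nonempty) {x : ℝ} :
    contraction A x = x ↔ ∃ a ∈ A, ∃ k : ℤ, x = a + k := by
  rw [← circleInfDist_eq_zero_iff hA, contraction_apply]
  constructor <;> intro h <;> linarith

/-- Points slightly to the right of `x` contract onto the last translate of `A` before `x`. -/
theorem exists_tendsto_contraction_iterate (hA : A.Nonempty) (x : ℝ) :
    ∃ a ∈ A, ∃ k : ℤ, ∃ y, a + k ≤ x ∧ x < y ∧
      Filter.Tendsto (fun m : ℕ => (contraction A)^[m] y) Filter.atTop (nhds (a + k)) := by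
  obtain ⟨a, ha, hmax⟩ := A.exists_max_image (fun a => a + (⌊x - a⌋ : ℝ)) hA
  obtain ⟨c, hc, hmin⟩ := A.exists_min_image (fun a => a + (⌊x - a⌋ : ℝ)) hA
  have hax : a + (⌊x - a⌋ : ℝ) ≤ x := by linarith [Int.floor_le (x - a)]
  have hcx : x < c + (⌊x - c⌋ : ℝ) + 1 := by linarith [Int.lt_floor_add_one (x - c)]
  obtain ⟨y, hxy, hyc⟩ := exists_between hcx
  have hfix : contraction A (a + (⌊x - a⌋ : ℝ)) = a + (⌊x - a⌋ : ℝ) :=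
    (contraction_eq_self_iff hA).2 ⟨a, ha, _, rfl⟩
  refine ⟨a, ha, ⌊x - a⌋, y, hax, hxy, ?_⟩
  have hanti : Antitone fun m : ℕ => (contraction A)^[m] y := antitone_nat_of_succ_le fun m => by
    rw [Function.iterate_succ_apply']; exact contraction_le A _
  have hlow : ∀ m : ℕ, a + (⌊x - a⌋ : ℝ) ≤ (contraction A)^[m] y := fun m => by
    have := (contraction A).monotone.iterate m (hax.trans hxy.le)
    rwa [Function.iterate_fixed hfix] at this
  have hlim := tendsto_atTop_ciInf hanti ⟨_, Set.forall_mem_range.2 hlow⟩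
  set L := ⨅ m : ℕ, (contraction A)^[m] y
  have hL : contraction A L = L :=
    isFixedPt_of_tendsto_iterate hlim (continuous_contraction A).continuousAt
  have haL : a + (⌊x - a⌋ : ℝ) ≤ L := ge_of_tendsto' hlim hlow
  have hLy : L ≤ y := le_of_tendsto' hlim fun m => hanti (Nat.zero_le m)
  suffices L = a + (⌊x - a⌋ : ℝ) by rwa [this] at hlim
  refine le_antisymm ?_ haL
  obtain ⟨d, hd, k, hk⟩ := (contraction_eq_self_iff hA).1 hL
  have hkd : k ≤ ⌊x - d⌋ := by
    by_contra! hlt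
    have h1 : ((⌊x - d⌋ : ℝ)) + 1 ≤ k := by exact_mod_cast hlt
    linarith [hmin d hd]
  have : (k : ℝ) ≤ ⌊x - d⌋ := by exact_mod_cast hkd
  linarith [hmax d hd]

end Contraction

/-! ### Lowering the translation number while keeping finitely many values -/

section Orbits

variable {X : Type*} (F : CircleDeg1Lift) {β : X → X} {k : X → ℤ} {E : X → ℝ}

theorem iterate_le_of_map_le (h : ∀ a, F (E a) ≤ E (β a) + k a) (q : ℕ) (a : X) :
    F^[q] (E a) ≤ E (β^[q] a) + (∑ j ∈ Finset.range q, k (β^[j] a) : ℤ) := by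
  induction q with
  | zero => simp
  | succ q ih =>
    rw [Function.iterate_succ_apply', Function.iterate_succ_apply', Finset.sum_range_succ]
    refine (F.monotone ih).trans ?_
    rw [F.map_add_int]
    push_cast
    linarith [h (β^[q] a)]

theorem le_iterate_of_le_map (h : ∀ a, E (β a) + k a ≤ F (E a)) (q : ℕ) (a : X) :
    E (β^[q] a) + (∑ j ∈ Finset.range q, k (β^[j] a) : ℤ) ≤ F^[q] (E a) := by
  induction q with
  | zero => simp
  | succ q ih =>
    rw [Function.iterate_succ_apply', Function.iterate_succ_apply', Finset.sum_range_succ]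
    refine le_trans ?_ (F.monotone ih)
    rw [F.map_add_int]
    push_cast
    linarith [h (β^[q] a)]

theorem translationNumber_le_div {q : ℕ} (hq : 0 < q) {p : ℤ} {x : ℝ} (h : F^[q] x ≤ x + p) :
    translationNumber F ≤ p / q := by
  rw [← CircleDeg1Lift.coe_pow] at h
  have := CircleDeg1Lift.translationNumber_le_of_le_add_int _ h
  rw [CircleDeg1Lift.translationNumber_pow] at this
  rw [le_div_iff₀ (by exact_mod_cast hq)]
  linarith

theorem div_le_translationNumber {q : ℕ} (hq : 0 < q) {p : ℤ} {x : ℝ} (h : x + p ≤ F^[q] x) :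
    p / q ≤ translationNumber F := by
  rw [← CircleDeg1Lift.coe_pow] at h
  have := CircleDeg1Lift.le_translationNumber_of_add_int_le _ h
  rw [CircleDeg1Lift.translationNumber_pow] at this
  rw [div_le_iff₀ (by exact_mod_cast hq)]
  linarith

theorem exists_iterate_eq_self [Fintype X] [Nonempty X] (β : X → X) :
    ∃ (x : X) (q : ℕ), 0 < q ∧ q ≤ Fintype.card X ∧ β^[q] x = x := by
  obtain ⟨x₀⟩ := ‹Nonempty X›
  obtain ⟨i, j, hij, h⟩ := Fintype.exists_ne_map_eq_of_card_lt
    (fun i : Fin (Fintype.card X + 1) => β^[i] x₀) (by simp)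
  wlog hlt : i < j generalizing i j
  · exact this j i hij.symm h.symm (lt_of_le_of_ne (not_lt.1 hlt) hij.symm)
  have hlt' : (i : ℕ) < j := hlt
  refine ⟨β^[i] x₀, j - i, by omega, by omega, ?_⟩
  rw [← Function.iterate_add_apply, Nat.sub_add_cancel hlt'.le]
  exact h.symm

end Orbits

/-- A circle homeomorphism can be replaced, without changing its values on a finite set `A`, by
one whose translation number is at most a rational number `p / q ≤ τ(f)` with `q ≤ #A`. -/
theorem exists_eqOn_tau_le_div (f : CircleDeg1Liftˣ) {A : Finset ℝ} (hA : A.Nonempty) :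
    ∃ h : CircleDeg1Liftˣ, (∀ a ∈ A, h a = f a) ∧
      ∃ (p : ℤ) (q : ℕ), 0 < q ∧ q ≤ A.card ∧ (p / q : ℝ) ≤ tau f ∧ tau h ≤ p / q := by
  choose b hb k y hbk hy hlim using fun a : A => exists_tendsto_contraction_iterate hA (f a)
  let β : A → A := fun a => ⟨b a, hb a⟩
  have hev : ∀ a : A, ∀ᶠ m : ℕ in Filter.atTop,
      f ((contraction A)^[m] (y a)) < y (β a) + k a := by
    intro a
    refine (((CircleDeg1Lift.continuous_units f).tendsto _).comp (hlim a)).eventually_lt_const ?_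
    rw [CircleDeg1Lift.map_add_int]
    linarith [hy (β a)]
  obtain ⟨m, hm⟩ := (Filter.eventually_all.2 hev).exists
  obtain ⟨u, hu⟩ := isUnit_contraction A
  have hval : ∀ x, (f * u ^ m : CircleDeg1Liftˣ) x = f ((contraction A)^[m] x) := fun x => by
    simp [hu, ← CircleDeg1Lift.coe_pow]
  have : Nonempty A := hA.to_subtype
  obtain ⟨a, q, hq, hqA, haq⟩ := exists_iterate_eq_self β
  refine ⟨f * u ^ m, fun c hc => ?_, ∑ j ∈ Finset.range q, k (β^[j] a), q, hq, by simpa using hqA,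
    ?_, ?_⟩
  · rw [hval, Function.iterate_fixed]
    exact (contraction_eq_self_iff hA).2 ⟨c, hc, 0, by simp⟩
  · have := le_iterate_of_le_map (f : CircleDeg1Lift) (E := fun a : A => (a : ℝ)) (β := β) hbk q a
    rw [haq] at this
    exact div_le_translationNumber _ hq this
  · have := iterate_le_of_map_le ((f * u ^ m : CircleDeg1Liftˣ) : CircleDeg1Lift) (E := y) (β := β)
      (k := k) (fun a => by rw [hval]; exact (hm a).le) q a
    rw [haq] at this
    exact translationNumber_le_div _ hq this

/-! ### Evaluation of positive words -/

section Words

variable {n : ℕ}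

theorem lift_of_mul_apply (f : Fin n → CircleDeg1Liftˣ) (i : Fin n) (w : FreeMonoid (Fin n))
    (x : ℝ) : (FreeMonoid.lift f (FreeMonoid.of i * w)) x = f i ((FreeMonoid.lift f w) x) := by
  simp

theorem lift_mono {f g : Fin n → CircleDeg1Liftˣ}
    (h : ∀ i, (f i : CircleDeg1Lift) ≤ g i) (w : FreeMonoid (Fin n)) :
    ((FreeMonoid.lift f w : CircleDeg1Liftˣ) : CircleDeg1Lift) ≤
      (FreeMonoid.lift g w : CircleDeg1Liftˣ) := by
  intro x
  induction w using FreeMonoid.inductionOn' with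
  | one => simp
  | of_mul i w ih =>
    have := ((f i : CircleDeg1Lift).monotone ih).trans (h i _)
    simpa using this

theorem lift_apply_le {f : Fin n → CircleDeg1Liftˣ} {C : ℝ} (h : ∀ i x, f i x ≤ x + C)
    (w : FreeMonoid (Fin n)) (x : ℝ) : (FreeMonoid.lift f w) x ≤ x + w.length * C := by
  induction w using FreeMonoid.inductionOn' with
  | one => simp
  | of_mul i w ih =>
    rw [lift_of_mul_apply, FreeMonoid.length_mul, FreeMonoid.length_of]
    push_cast
    linarith [h i ((FreeMonoid.lift f w) x)]

/-- The value of a word at a point depends only on finitely many values of the letters. -/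
theorem exists_finset_lift_apply_eq (f : Fin n → CircleDeg1Liftˣ) (w : FreeMonoid (Fin n))
    (x : ℝ) : ∃ A : Finset ℝ, A.Nonempty ∧ A.card ≤ w.length + 1 ∧
      ∀ h : Fin n → CircleDeg1Liftˣ, (∀ i, ∀ a ∈ A, h i a = f i a) →
        (FreeMonoid.lift h w) x = (FreeMonoid.lift f w) x := by
  induction w using FreeMonoid.inductionOn' with
  | one => exact ⟨{x}, by simp, by simp, by simp⟩
  | of_mul i w ih =>
    obtain ⟨A, -, hcard, hA⟩ := ih
    refine ⟨insert ((FreeMonoid.lift f w) x) A, Finset.insert_nonempty _ _, ?_, fun h hh => ?_⟩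
    · rw [FreeMonoid.length_mul, FreeMonoid.length_of]
      exact (Finset.card_insert_le _ _).trans (by omega)
    · rw [lift_of_mul_apply, lift_of_mul_apply,
        hA h fun i a ha => hh i a (Finset.mem_insert_of_mem ha)]
      exact hh i _ (Finset.mem_insert_self _ _)

theorem FreeMonoid.length_pow {α : Type*} (w : FreeMonoid α) (q : ℕ) :
    (w ^ q).length = q * w.length := by
  induction q with
  | zero => simp
  | succ q ih => rw [pow_succ, FreeMonoid.length_mul, ih]; ring

theorem rotSet_nonempty (w : FreeMonoid (Fin n)) (s : Fin n → ℝ) : (rotSet w s).Nonempty :=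
  ⟨_, fun i => translate (Multiplicative.ofAdd (s i)),
    fun i => CircleDeg1Lift.translationNumber_translate (s i), rfl⟩

theorem rotSet_bddAbove (w : FreeMonoid (Fin n)) (s : Fin n → ℝ) : BddAbove (rotSet w s) := by
  obtain ⟨C, hC⟩ := (Set.finite_range s).bddAbove
  refine ⟨w.length * (C + 1), ?_⟩
  rintro _ ⟨f, hf, rfl⟩
  refine CircleDeg1Lift.translationNumber_le_of_le_add _ (lift_apply_le (fun i x => ?_) w)
  have h1 := (f i : CircleDeg1Lift).map_lt_add_translationNumber_add_one x
  have h2 : translationNumber (f i : CircleDeg1Lift) = s i := hf i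
  have h3 := hC (Set.mem_range_self i)
  linarith

theorem le_Rw_of_tau_le {w : FreeMonoid (Fin n)} {s : Fin n → ℝ} {f : Fin n → CircleDeg1Liftˣ}
    (h : ∀ i, tau (f i) ≤ s i) : tau (FreeMonoid.lift f w) ≤ Rw w s := by
  choose g hfg hg using fun i => exists_ge_tau_eq (f i) (h i)
  exact (CircleDeg1Lift.translationNumber_mono (lift_mono hfg w)).trans
    (le_csSup (rotSet_bddAbove w s) ⟨g, hg, rfl⟩)

theorem Rw_mono (w : FreeMonoid (Fin n)) : Monotone (Rw w) := by
  intro s t hst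
  refine csSup_le (rotSet_nonempty w s) ?_
  rintro _ ⟨f, hf, rfl⟩
  exact le_Rw_of_tau_le fun i => (hf i).trans_le (hst i)

end Words

/-- Just above any real number there is a rational with no fraction of small denominator
in between. -/
theorem exists_rat_ge_forall_div_le (s : ℝ) (N : ℕ) :
    ∃ r : ℚ, s ≤ r ∧ ∀ (p : ℤ) (q : ℕ), 0 < q → q ≤ N → (p / q : ℝ) ≤ r → (p / q : ℝ) ≤ s := by
  have hM : (0 : ℝ) < N.factorial := by exact_mod_cast N.factorial_pos
  have hlt : s < (⌊N.factorial * s⌋ + 1) / N.factorial := by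
    rw [lt_div_iff₀ hM, mul_comm]; exact Int.lt_floor_add_one _
  obtain ⟨r, hsr, hr⟩ := exists_rat_btwn hlt
  refine ⟨r, hsr.le, fun p q hq hqN hpq => ?_⟩
  obtain ⟨d, hd⟩ := Nat.dvd_factorial hq hqN
  have hq' : (0 : ℝ) < q := by exact_mod_cast hq
  have hint : (p / q : ℝ) = (p * d : ℤ) / N.factorial := by
    have hd' : (N.factorial : ℝ) = q * d := by exact_mod_cast hd
    have hd0 : (d : ℝ) ≠ 0 := fun h => by rw [hd', h, mul_zero] at hM; exact hM.false
    rw [hd']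
    push_cast
    field_simp
  rw [hint] at hpq ⊢
  have h1 := (div_lt_div_iff_of_pos_right hM).1 (hpq.trans_lt hr)
  have h2 : p * d ≤ ⌊N.factorial * s⌋ := Int.lt_add_one_iff.1 (by exact_mod_cast h1)
  rw [div_le_iff₀ hM, mul_comm s]
  exact Int.le_floor.1 h2

theorem div_le_Rw {n : ℕ} {w : FreeMonoid (Fin n)} {s r : Fin n → ℝ} {P : ℤ} {Q : ℕ} (hQ : 0 < Q)
    (hr : ∀ i (p : ℤ) (q : ℕ), 0 < q → q ≤ Q * w.length + 1 → (p / q : ℝ) ≤ r i →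
      (p / q : ℝ) ≤ s i)
    (hlt : (P / Q : ℝ) < Rw w r) : (P / Q : ℝ) ≤ Rw w s := by
  obtain ⟨_, ⟨f, hf, rfl⟩, hPf⟩ := exists_lt_of_lt_csSup (rotSet_nonempty w r) hlt
  obtain ⟨A, hA, hcard, hAf⟩ := exists_finset_lift_apply_eq f (w ^ Q) 0
  rw [FreeMonoid.length_pow] at hcard
  choose h hfh p q hq hqA hpf hhp using fun i => exists_eqOn_tau_le_div (f i) hA
  refine le_trans ?_ (le_Rw_of_tau_le (w := w) fun i => (hhp i).trans
    (hr i (p i) (q i) (hq i) ((hqA i).trans hcard) ((hpf i).trans (hf i).le)))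
  have hpow : ∀ g : Fin n → CircleDeg1Liftˣ,
      (FreeMonoid.lift g (w ^ Q)) 0 = (FreeMonoid.lift g w : CircleDeg1Lift)^[Q] 0 := fun g => by
    simp [← CircleDeg1Lift.coe_pow]
  refine div_le_translationNumber _ hQ (x := 0) ?_
  rw [← hpow, hAf h hfh]
  refine (CircleDeg1Lift.lt_map_of_int_lt_translationNumber _ ?_ 0).le
  rw [map_pow, Units.val_pow_eq_pow_val, CircleDeg1Lift.translationNumber_pow]
  rw [div_lt_iff₀ (by exact_mod_cast hQ), mul_comm] at hPf
  exact hPf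

/-- `R_w` is determined by its values at rational arguments:
`R_w(s₁,…,sₙ) = inf { R_w(r₁,…,rₙ) : rᵢ ∈ ℚ, rᵢ ≥ sᵢ }`. -/
theorem Rw_eq_sInf_rational {n : ℕ} (w : FreeMonoid (Fin n)) (hw : w ≠ 1)
    (s : Fin n → ℝ) :
    Rw w s = sInf {y : ℝ | ∃ r : Fin n → ℚ, (∀ i, s i ≤ (r i : ℝ)) ∧
      y = Rw w (fun i => (r i : ℝ))} := by
  have hlow : ∀ y ∈ {y : ℝ | ∃ r : Fin n → ℚ, (∀ i, s i ≤ (r i : ℝ)) ∧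
      y = Rw w (fun i => (r i : ℝ))}, Rw w s ≤ y := by
    rintro _ ⟨r, hr, rfl⟩
    exact Rw_mono w hr
  refine le_antisymm (le_csInf ?_ hlow) (le_of_forall_rat_lt_imp_le fun c hc => ?_)
  · choose r hr using fun i => exists_rat_gt (s i)
    exact ⟨_, r, fun i => (hr i).le, rfl⟩
  · choose r hsr hr using fun i => exists_rat_ge_forall_div_le (s i) (c.den * w.length + 1)
    have hRr := hc.trans_le (csInf_le ⟨_, hlow⟩ ⟨r, hsr, rfl⟩)
    rw [Rat.cast_def] at hRr ⊢
    exact div_le_Rw c.den_pos hr hRr
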